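/- Fix integers r, s ≥ 1 and let (X_n)_{n≥0} be the time-inhomogeneous Markov chain on Σ_N with arbitrary initial distribution in which the transition from X_{m−1} to X_m (m ≥ 1) is governed by P_{A'}^{(N)} if (m−1) mod (r+s) < r and by P_B^{(N)} otherwise (i.e., the pattern (A')^r B^s repeated ad infinitum). Then almost surely S_n/n → μ_{[r,s]}^{(N)} := N·E_{r,s}/D_{r,s} as n → ∞. -/

import Mathlib

open MeasureTheory Filter

noncomputable section ToralPattern

/-- `a_r := (1 − (1 − 3/N)^r)/3`. -/
def aR (N r : ℕ) : ℝ := (1 - (1 - 3 / (N : ℝ)) ^ r) / 3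

/-- `S := √((1+ρ²)(1+4ρ+ρ²))`. -/
def Sq (ρ : ℝ) : ℝ := Real.sqrt ((1 + ρ ^ 2) * (1 + 4 * ρ + ρ ^ 2))

/-- `e₁° := −1/2 + (1−ρ)S/(2(1+ρ)(1+ρ²))`. -/
def e1c (ρ : ℝ) : ℝ := -(1 / 2) + (1 - ρ) * Sq ρ / (2 * (1 + ρ) * (1 + ρ ^ 2))

/-- `e₂° := −1/2 − (1−ρ)S/(2(1+ρ)(1+ρ²))`. -/
def e2c (ρ : ℝ) : ℝ := -(1 / 2) - (1 - ρ) * Sq ρ / (2 * (1 + ρ) * (1 + ρ ^ 2))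

/-- `e₁ := 1 − (1 − e₁°)/N`. -/
def e1 (N : ℕ) (ρ : ℝ) : ℝ := 1 - (1 - e1c ρ) / (N : ℝ)

/-- `e₂ := 1 − (1 − e₂°)/N`. -/
def e2 (N : ℕ) (ρ : ℝ) : ℝ := 1 - (1 - e2c ρ) / (N : ℝ)

/-- The numerator `E_{r,s}`. -/
def Ers (N r s : ℕ) (ρ : ℝ) : ℝ :=
  3 * aR N r *
    ((2 + (3 * aR N r - 1) * (e1 N ρ ^ s + e2 N ρ ^ s - 2 * e1 N ρ ^ s * e2 N ρ ^ s)
        - (e1 N ρ ^ s + e2 N ρ ^ s)) * (1 - ρ) * (1 + ρ) * Sq ρ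
      + aR N r * (e2 N ρ ^ s - e1 N ρ ^ s) * (5 * (1 + ρ) ^ 2 * (1 + ρ ^ 2) - 4 * ρ ^ 2))
    * (1 - ρ) ^ 2

/-- The denominator `D_{r,s}`. -/
def Drs (N r s : ℕ) (ρ : ℝ) : ℝ :=
  4 * ((r : ℝ) + (s : ℝ)) * (1 + (3 * aR N r - 1) * e1 N ρ ^ s)
    * (1 + (3 * aR N r - 1) * e2 N ρ ^ s) * (1 + ρ + ρ ^ 2) ^ 2 * Sq ρ

/-- The mean profit per turn `μ_{[r,s]}^{(N)} := N·E_{r,s}/D_{r,s}`. -/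
def muRS (N r s : ℕ) (ρ : ℝ) : ℝ := (N : ℝ) * Ers N r s ρ / Drs N r s ρ

end ToralPattern



lemma aux_orth {X : Type} [Fintype X] [MeasurableSpace X] [MeasurableSingletonClass X]
    (μ : Measure (ℕ → X)) [IsProbabilityMeasure μ] (P : ℕ → X → X → ℝ)
    (hP : ∀ n x y, 0 ≤ P n x y)
    (hM : ∀ (n : ℕ) (f : ℕ → X) (y : X), μ {ω | (∀ i ≤ n, ω i = f i) ∧ ω (n + 1) = y}
        = μ {ω | ∀ i ≤ n, ω i = f i} * ENNReal.ofReal (P n (f n) y))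
    (d : ℕ → X → X → ℝ) (h0 : ∀ n x, ∑ y, P n x y * d n x y = 0)
    (n : ℕ) (Φ : (Fin (n + 1) → X) → ℝ) :
    ∫ ω, Φ (fun i => ω i) * d n (ω n) (ω (n + 1)) ∂μ = 0 := by
  classical
  let T : (ℕ → X) → (Fin (n + 1) → X) × X := fun ω => (fun i => ω i, ω (n + 1))
  have hT : Measurable T := by fun_prop
  let F : (Fin (n + 1) → X) × X → ℝ := fun t => Φ t.1 * d n (t.1 (Fin.last n)) t.2
  have h1 : ∫ ω, Φ (fun i => ω i) * d n (ω n) (ω (n + 1)) ∂μ = ∫ t, F t ∂(μ.map T) := by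
    rw [integral_map hT.aemeasurable (measurable_of_countable F).aestronglyMeasurable]
    simp [F, T]
  rw [h1]
  have : IsProbabilityMeasure (μ.map T) := Measure.isProbabilityMeasure_map hT.aemeasurable
  rw [integral_fintype .of_finite, Fintype.sum_prod_type]
  refine Finset.sum_eq_zero fun p _ => ?_
  let f : ℕ → X := fun i => if h : i < n + 1 then p ⟨i, h⟩ else p 0
  have key : ∀ y, (μ.map T).real {(p, y)} =
      μ.real {ω | ∀ i ≤ n, ω i = f i} * P n (p (Fin.last n)) y := by
    intro y
    have e : T ⁻¹' {(p, y)} = {ω | (∀ i ≤ n, ω i = f i) ∧ ω (n + 1) = y} := by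
      ext ω
      simp only [T, Set.mem_preimage, Set.mem_singleton_iff, Prod.mk.injEq, Set.mem_ofPred_eq]
      refine and_congr_left fun _ => ?_
      constructor
      · rintro h i hi
        have := congrFun h ⟨i, Nat.lt_succ_of_le hi⟩
        simp only [f, Nat.lt_succ_of_le hi, dif_pos]; exact this
      · intro h; ext i
        have := h i (Nat.le_of_lt_succ i.2)
        simp only [f, i.2, dif_pos] at this; exact this
    rw [measureReal_def, Measure.map_apply hT (measurableSet_singleton _), e, hM,
      ENNReal.toReal_mul, ENNReal.toReal_ofReal (hP _ _ _), measureReal_def]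
    simp [f, Fin.last]
  have : ∀ y, (μ.map T).real {(p, y)} • F (p, y) =
      (μ.real {ω | ∀ i ≤ n, ω i = f i} * Φ p) *
        (P n (p (Fin.last n)) y * d n (p (Fin.last n)) y) := by
    intro y
    rw [key]; simp only [F, smul_eq_mul]; ring
  simp_rw [this]
  rw [← Finset.mul_sum, h0, mul_zero]

lemma aux_mono (C : ℝ) (D : ℕ → ℝ) (hC : ∀ n, |D n| ≤ C)
    (h : Tendsto (fun m : ℕ => (∑ k ∈ Finset.range (m ^ 2), D k) / ((m ^ 2 : ℕ) : ℝ)) atTop (nhds 0)) :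
    Tendsto (fun n : ℕ => (∑ k ∈ Finset.range n, D k) / (n : ℝ)) atTop (nhds 0) := by
  have h1 : Tendsto (fun n : ℕ => (∑ k ∈ Finset.range n, (D k + C)) / (n : ℝ)) atTop (nhds C) := by
    refine tendsto_div_of_monotone_of_exists_subseq_tendsto_div _ _ ?_ ?_
    · refine monotone_nat_of_le_succ fun n => ?_
      rw [Finset.sum_range_succ]
      have := abs_le.1 (hC n)
      linarith
    · intro a ha
      refine ⟨fun m => m ^ 2, ?_, tendsto_pow_atTop (by norm_num), ?_⟩
      · have : Tendsto (fun n : ℕ => (1 + 1 / (n : ℝ)) ^ 2) atTop (nhds ((1 + 0) ^ 2)) :=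
          (tendsto_const_nhds.add tendsto_one_div_atTop_nhds_zero_nat).pow 2
        have h2 := this.eventually (gt_mem_nhds (show ((1 + 0 : ℝ)) ^ 2 < a by simpa using ha))
        filter_upwards [h2, eventually_gt_atTop 0] with n hn hn0
        have hn0' : (0 : ℝ) < n := by exact_mod_cast hn0
        push_cast
        have : ((n : ℝ) + 1) ^ 2 = (1 + 1 / (n : ℝ)) ^ 2 * (n : ℝ) ^ 2 := by field_simp
        rw [this]
        gcongr
      · have := h.add_const C
        rw [zero_add] at this
        refine this.congr' ?_
        filter_upwards [eventually_gt_atTop 0] with n hn0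
        have hn0' : (n : ℝ) ≠ 0 := by exact_mod_cast hn0.ne'
        rw [Finset.sum_add_distrib]
        simp
        field_simp
  have h2 := h1.sub_const C
  rw [sub_self] at h2
  refine h2.congr' ?_
  filter_upwards [eventually_gt_atTop 0] with n hn0
  have hn0' : (n : ℝ) ≠ 0 := by exact_mod_cast hn0.ne'
  rw [Finset.sum_add_distrib]
  simp
  field_simp
  ring

lemma aux_slln {X : Type} [Fintype X] [MeasurableSpace X] [MeasurableSingletonClass X]
    (μ : Measure (ℕ → X)) [IsProbabilityMeasure μ] (P : ℕ → X → X → ℝ)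
    (hP : ∀ n x y, 0 ≤ P n x y)
    (hM : ∀ (n : ℕ) (f : ℕ → X) (y : X), μ {ω | (∀ i ≤ n, ω i = f i) ∧ ω (n + 1) = y}
        = μ {ω | ∀ i ≤ n, ω i = f i} * ENNReal.ofReal (P n (f n) y))
    (d : ℕ → X → X → ℝ) (h0 : ∀ n x, ∑ y, P n x y * d n x y = 0)
    (C : ℝ) (hC : ∀ n x y, |d n x y| ≤ C) :
    ∀ᵐ ω ∂μ, Tendsto (fun n : ℕ => (∑ m ∈ Finset.range n, d m (ω m) (ω (m + 1))) / (n : ℝ))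
      atTop (nhds 0) := by
  let S : ℕ → (ℕ → X) → ℝ := fun n ω => ∑ m ∈ Finset.range n, d m (ω m) (ω (m + 1))
  have hd : ∀ m, Measurable (fun ω : ℕ → X => d m (ω m) (ω (m + 1))) := fun m =>
    (measurable_of_countable (fun q : X × X => d m q.1 q.2)).comp
      (show Measurable (fun ω : ℕ → X => (ω m, ω (m + 1))) by fun_prop)
  have hS : ∀ n, Measurable (S n) := fun n => Finset.measurable_sum _ fun m _ => hd m
  have hSb : ∀ n ω, |S n ω| ≤ n * C := by
    intro n ω
    refine (Finset.abs_sum_le_sum_abs _ _).trans ?_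
    refine (Finset.sum_le_sum fun m _ => hC m _ _).trans ?_
    simp
  have hI : ∀ (f : (ℕ → X) → ℝ) (K : ℝ), Measurable f → (∀ ω, |f ω| ≤ K) → Integrable f μ :=
    fun f K hf hK => Integrable.of_bound hf.aestronglyMeasurable K (ae_of_all _ hK)
  have hI2 : ∀ n, Integrable (fun ω => S n ω ^ 2) μ := fun n =>
    hI _ ((n * C) ^ 2) ((hS n).pow_const 2) fun ω => by
      rw [abs_pow]; exact pow_le_pow_left₀ (abs_nonneg _) (hSb n ω) 2
  have hID : ∀ n, Integrable (fun ω : ℕ → X => d n (ω n) (ω (n + 1)) ^ 2) μ := fun n =>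
    hI _ (C ^ 2) ((hd n).pow_const 2) fun ω => by
      rw [abs_pow]; exact pow_le_pow_left₀ (abs_nonneg _) (hC n _ _) 2
  have hIX : ∀ n, Integrable (fun ω : ℕ → X => S n ω * d n (ω n) (ω (n + 1))) μ := fun n =>
    hI _ (n * C * C) ((hS n).mul (hd n)) fun ω => by
      rw [abs_mul]
      exact mul_le_mul (hSb n ω) (hC n _ _) (abs_nonneg _) ((abs_nonneg _).trans (hSb n ω))
  have hE : ∀ n, ∫ ω, S n ω ^ 2 ∂μ ≤ n * C ^ 2 := by
    intro n
    induction n with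
    | zero => simp [S]
    | succ n ih =>
      have hz : ∫ ω, S n ω * d n (ω n) (ω (n + 1)) ∂μ = 0 := by
        have := aux_orth μ P hP hM d h0 n (fun p => ∑ m : Fin n, d m (p m.castSucc) (p m.succ))
        simpa [S, Finset.sum_range] using this
      have e : ∀ ω, S (n + 1) ω ^ 2 = (S n ω ^ 2 + 2 * (S n ω * d n (ω n) (ω (n + 1))))
          + d n (ω n) (ω (n + 1)) ^ 2 := by
        intro ω
        have : S (n + 1) ω = S n ω + d n (ω n) (ω (n + 1)) := Finset.sum_range_succ _ _
        rw [this]; ring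
      have hsum2 : Integrable (fun ω : ℕ → X => S n ω ^ 2 + 2 * (S n ω * d n (ω n) (ω (n + 1)))) μ :=
        (hI2 n).add ((hIX n).const_mul 2)
      simp_rw [e]
      rw [integral_add hsum2 (hID n),
        integral_add (hI2 n) ((hIX n).const_mul 2), integral_const_mul, hz]
      have : ∫ ω : ℕ → X, d n (ω n) (ω (n + 1)) ^ 2 ∂μ ≤ C ^ 2 := by
        have := integral_mono (hID n) (integrable_const (μ := μ) (C ^ 2)) (fun ω => by
          rw [← sq_abs]; exact pow_le_pow_left₀ (abs_nonneg _) (hC n _ _) 2)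
        simpa using this
      push_cast
      linarith
  have hsum : ∑' m : ℕ, ∫⁻ ω, ENNReal.ofReal ((S (m ^ 2) ω / ((m ^ 2 : ℕ) : ℝ)) ^ 2) ∂μ ≠ ⊤ := by
    have hb : ∀ m : ℕ, ∫⁻ ω, ENNReal.ofReal ((S (m ^ 2) ω / ((m ^ 2 : ℕ) : ℝ)) ^ 2) ∂μ
        ≤ ENNReal.ofReal (C ^ 2 * (1 / (m : ℝ) ^ 2)) := by
      intro m
      have e : ∀ ω, (S (m ^ 2) ω / ((m ^ 2 : ℕ) : ℝ)) ^ 2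
          = S (m ^ 2) ω ^ 2 * (1 / ((m ^ 2 : ℕ) : ℝ) ^ 2) := fun ω => by
        rw [div_pow]; ring
      simp_rw [e]
      rw [← ofReal_integral_eq_lintegral_ofReal ((hI2 _).mul_const _)
        (ae_of_all _ fun ω => by positivity), integral_mul_const]
      refine ENNReal.ofReal_le_ofReal ?_
      refine (mul_le_mul_of_nonneg_right (hE _) (by positivity)).trans ?_
      rcases Nat.eq_zero_or_pos m with rfl | hm
      · simp
      · have hn0' : (m : ℝ) ≠ 0 := by exact_mod_cast hm.ne'
        push_cast
        refine le_of_eq ?_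
        field_simp
    refine ne_top_of_le_ne_top ?_ (ENNReal.tsum_le_tsum hb)
    have : Summable fun m : ℕ => C ^ 2 * (1 / (m : ℝ) ^ 2) :=
      (Real.summable_one_div_nat_pow.2 (by norm_num)).mul_left _
    exact this.tsum_ofReal_ne_top
  rw [← lintegral_tsum (fun m => (((hS _).div_const _).pow_const 2).ennreal_ofReal.aemeasurable)]
    at hsum
  have hae := ae_lt_top' (Measurable.tsum fun m =>
    (((hS _).div_const _).pow_const 2).ennreal_ofReal).aemeasurable hsum
  filter_upwards [hae] with ω hω
  refine aux_mono C _ (fun n => hC n _ _) ?_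
  have h1 := ENNReal.tendsto_atTop_zero_of_tsum_ne_top hω.ne
  have h2 := (ENNReal.tendsto_toReal ENNReal.zero_ne_top).comp h1
  have h3 : Tendsto (fun m : ℕ => (S (m ^ 2) ω / ((m ^ 2 : ℕ) : ℝ)) ^ 2) atTop (nhds 0) := by
    refine (h2.congr fun m => ?_)
    simp only [Function.comp]
    rw [ENNReal.toReal_ofReal (by positivity)]
  have h4 := h3.sqrt
  simp only [Real.sqrt_sq_eq_abs, Real.sqrt_zero] at h4
  exact (tendsto_zero_iff_abs_tendsto_zero _).2 h4

lemma aux_eig (ρ : ℝ) (hρ : 0 < ρ) (p : ZMod 3 → ℝ)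
    (hp : ∀ z, p z = if z = 0 then ρ ^ 2 / (1 + ρ ^ 2) else 1 / (1 + ρ)) :
    ∃ u1 u2 : ZMod 3 → ℝ, (∀ z, u1 z + u2 z = 2 * p z - 1) ∧
      (∀ z, p z * u1 (z + 1) + (1 - p z) * u1 (z - 1) = e1c ρ * u1 z) ∧
      (∀ z, p z * u2 (z + 1) + (1 - p z) * u2 (z - 1) = e2c ρ * u2 z) ∧
      (∑ z, u1 z) / 3 = (1 - e1c ρ) * (((1 - ρ) * (1 + ρ) * Sq ρ
        + (5 * (1 + ρ) ^ 2 * (1 + ρ ^ 2) - 4 * ρ ^ 2) / 3) * (1 - ρ) ^ 2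
        / (4 * (1 + ρ + ρ ^ 2) ^ 2 * Sq ρ)) ∧
      (∑ z, u2 z) / 3 = (1 - e2c ρ) * (((1 - ρ) * (1 + ρ) * Sq ρ
        - (5 * (1 + ρ) ^ 2 * (1 + ρ ^ 2) - 4 * ρ ^ 2) / 3) * (1 - ρ) ^ 2
        / (4 * (1 + ρ + ρ ^ 2) ^ 2 * Sq ρ)) := by
  have hS : 0 < Sq ρ := Real.sqrt_pos.2 (by positivity)
  have hS2 : Sq ρ ^ 2 = (1 + ρ ^ 2) * (1 + 4 * ρ + ρ ^ 2) := Real.sq_sqrt (by positivity)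
  have h1 : (1 : ZMod 3) ≠ 0 := by decide
  have h2 : (2 : ZMod 3) ≠ 0 := by decide
  by_cases hρ1 : ρ = 1
  · subst hρ1
    refine ⟨fun _ => 0, fun _ => 0, ?_, ?_, ?_, ?_, ?_⟩ <;> simp
    intro z
    rw [hp]; split_ifs <;> norm_num
  have hne : (1 - ρ) ≠ 0 := sub_ne_zero.2 (Ne.symm hρ1)
  set S := Sq ρ with hSdef
  obtain ⟨ζ, hζ⟩ : ∃ ζ, ζ = (1 - ρ) * S / (2 * (1 + ρ) * (1 + ρ ^ 2)) := ⟨_, rfl⟩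
  have hζ0 : ζ ≠ 0 := by rw [hζ]; positivity
  have hζ2 : ζ ^ 2 = (1 - ρ) ^ 2 * (1 + 4 * ρ + ρ ^ 2) / (4 * (1 + ρ) ^ 2 * (1 + ρ ^ 2)) := by
    rw [hζ, div_pow, mul_pow, hS2]; field_simp; ring
  have he1 : e1c ρ = -(1 / 2) + ζ := by rw [hζ]; rfl
  have he2 : e2c ρ = -(1 / 2) - ζ := by rw [hζ]; rfl
  let φ : ZMod 3 → ℝ := fun z => 2 * p z - 1
  let b : ZMod 3 → ℝ := fun z => p z * φ (z + 1) + (1 - p z) * φ (z - 1)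
  have p0 : p 0 = ρ ^ 2 / (1 + ρ ^ 2) := by simp [hp]
  have p1 : p 1 = 1 / (1 + ρ) := by simp [hp]
  have p2 : p 2 = 1 / (1 + ρ) := by simp [hp, h2]
  have hb0 : b 0 = p 0 * φ 1 + (1 - p 0) * φ 2 := rfl
  have hb1 : b 1 = p 1 * φ 2 + (1 - p 1) * φ 0 := rfl
  have hb2 : b 2 = p 2 * φ 0 + (1 - p 2) * φ 1 := rfl
  have hCH : ∀ z, p z * b (z + 1) + (1 - p z) * b (z - 1) + b z + (1 / 4 - ζ ^ 2) * φ z = 0 := by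
    intro z
    fin_cases z
    · change p 0 * b 1 + (1 - p 0) * b 2 + b 0 + (1 / 4 - ζ ^ 2) * φ 0 = 0
      rw [hb0, hb1, hb2, hζ2]; simp only [φ]; rw [p0, p1, p2]; field_simp; ring
    · change p 1 * b 2 + (1 - p 1) * b 0 + b 1 + (1 / 4 - ζ ^ 2) * φ 1 = 0
      rw [hb0, hb1, hb2, hζ2]; simp only [φ]; rw [p0, p1, p2]; field_simp; ring
    · change p 2 * b 0 + (1 - p 2) * b 1 + b 2 + (1 / 4 - ζ ^ 2) * φ 2 = 0
      rw [hb0, hb1, hb2, hζ2]; simp only [φ]; rw [p0, p1, p2]; field_simp; ring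
  have hφs : ∑ z, φ z = φ 0 + φ 1 + φ 2 := Fin.sum_univ_three φ
  have hbs : ∑ z, b z = b 0 + b 1 + b 2 := Fin.sum_univ_three b
  have hS3 : S ^ 3 = S * ((1 + ρ ^ 2) * (1 + 4 * ρ + ρ ^ 2)) := by rw [← hS2]; ring
  refine ⟨fun z => (b z - e2c ρ * φ z) / (2 * ζ), fun z => (e1c ρ * φ z - b z) / (2 * ζ),
    ?_, ?_, ?_, ?_, ?_⟩
  · intro z
    change _ = φ z
    rw [he1, he2]; field_simp; ring
  · intro z
    have hb : b z = p z * φ (z + 1) + (1 - p z) * φ (z - 1) := rfl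
    have := hCH z
    rw [he1, he2]; field_simp
    linear_combination 4 * this - 2 * (-1 - 2 * ζ) * hb
  · intro z
    have hb : b z = p z * φ (z + 1) + (1 - p z) * φ (z - 1) := rfl
    have := hCH z
    rw [he1, he2]; field_simp
    linear_combination -4 * this + 2 * (-1 + 2 * ζ) * hb
  · rw [← Finset.sum_div, Finset.sum_sub_distrib, ← Finset.mul_sum, hφs, hbs, hb0, hb1, hb2, he2, he1]
    simp only [φ]; rw [p0, p1, p2, hζ]
    field_simp
    ring_nf
    try simp only [hS2]
    ring_nf
  · rw [← Finset.sum_div, Finset.sum_sub_distrib, ← Finset.mul_sum, hφs, hbs, hb0, hb1, hb2, he2, he1]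
    simp only [φ]; rw [p0, p1, p2, hζ]
    field_simp
    ring_nf
    try simp only [hS2]
    ring_nf

lemma aux_bd (ρ : ℝ) (hρ : 0 < ρ) (N : ℕ) (hN : 2 ≤ N) :
    e1c ρ < 1 ∧ e2c ρ < 1 ∧ 0 ≤ e1 N ρ ∧ e1 N ρ < 1 ∧ 0 ≤ e2 N ρ ∧ e2 N ρ < 1 := by
  have hS2 : Sq ρ ^ 2 = (1 + ρ ^ 2) * (1 + 4 * ρ + ρ ^ 2) := Real.sq_sqrt (by positivity)
  obtain ⟨ζ, hζ⟩ : ∃ ζ, ζ = (1 - ρ) * Sq ρ / (2 * (1 + ρ) * (1 + ρ ^ 2)) := ⟨_, rfl⟩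
  have hζ2 : ζ ^ 2 < (1 / 2) ^ 2 := by
    rw [hζ, div_pow, mul_pow, hS2, div_lt_iff₀ (by positivity)]
    have : 0 < ρ ^ 2 * (1 + ρ ^ 2) := by positivity
    nlinarith
  have he1 : e1c ρ = -(1 / 2) + ζ := by rw [hζ]; rfl
  have he2 : e2c ρ = -(1 / 2) - ζ := by rw [hζ]; rfl
  have hz := abs_lt.1 (abs_lt_of_sq_lt_sq hζ2 (by norm_num))
  have hN' : (2 : ℝ) ≤ N := by exact_mod_cast hN
  have g : ∀ e : ℝ, -1 < e → e < 1 → 0 ≤ 1 - (1 - e) / N ∧ 1 - (1 - e) / N < 1 := by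
    intro e h1 h2
    constructor
    · rw [sub_nonneg, div_le_one (by linarith)]; linarith
    · have : 0 < (1 - e) / N := by apply div_pos <;> linarith
      linarith
  have h1 := g (e1c ρ) (by rw [he1]; linarith) (by rw [he1]; linarith)
  have h2 := g (e2c ρ) (by rw [he2]; linarith) (by rw [he2]; linarith)
  exact ⟨by rw [he1]; linarith, by rw [he2]; linarith, h1.1, h1.2, h2.1, h2.2⟩

lemma aux_poisson (ρ : ℝ) (hρ : 0 < ρ) (N : ℕ) (hN : 2 ≤ N) (r s : ℕ) (hr : 1 ≤ r) (hs : 1 ≤ s)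
    (p : ZMod 3 → ℝ) (hp : ∀ z, p z = if z = 0 then ρ ^ 2 / (1 + ρ ^ 2) else 1 / (1 + ρ)) :
    ∃ h : ℕ → ZMod 3 → ℝ, (∃ C, ∀ n z, |h n z| ≤ C) ∧
      (∀ n z, n % (r + s) < r → h n z = h (n + 1) z
        + (1 / N) * (h (n + 1) (z + 1) + h (n + 1) (z - 1) - 2 * h (n + 1) z) - muRS N r s ρ / N) ∧
      (∀ n z, ¬ n % (r + s) < r → h n z = h (n + 1) z
        + (1 / N) * ((2 * p z - 1) + p z * h (n + 1) (z + 1) + (1 - p z) * h (n + 1) (z - 1)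
          - h (n + 1) z) - muRS N r s ρ / N) := by
  obtain ⟨u1, u2, hu, hB1, hB2, hm1, hm2⟩ := aux_eig ρ hρ p hp
  obtain ⟨hc1, hc2, h10, h11, h20, h21⟩ := aux_bd ρ hρ N hN
  have hN' : (2 : ℝ) ≤ N := by exact_mod_cast hN
  have hN0 : (N : ℝ) ≠ 0 := by linarith
  have hS : 0 < Sq ρ := Real.sqrt_pos.2 (by positivity)
  obtain ⟨β, hβ⟩ : ∃ β : ℝ, β = 1 - 3 / N := ⟨_, rfl⟩
  obtain ⟨m1, hm1'⟩ : ∃ m, m = (∑ z, u1 z) / 3 := ⟨_, rfl⟩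
  obtain ⟨m2, hm2'⟩ : ∃ m, m = (∑ z, u2 z) / 3 := ⟨_, rfl⟩
  rw [← hm1'] at hm1
  rw [← hm2'] at hm2
  have hβ1 : |β| ≤ 1 := by
    rw [hβ, abs_le]
    have h3 : (3 : ℝ) / N ≤ 3 / 2 := by gcongr
    have h4 : 0 ≤ (3 : ℝ) / N := by positivity
    constructor <;> linarith
  have hα : ∀ e : ℝ, 0 ≤ e → e < 1 → 0 < 1 - β ^ r * e ^ s := by
    intro e h0 h1
    have a1 : β ^ r ≤ 1 := (le_abs_self _).trans (by rw [abs_pow]; exact pow_le_one₀ (abs_nonneg _) hβ1)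
    have a2 : e ^ s < 1 := pow_lt_one₀ h0 h1 (by omega)
    have a3 : 0 ≤ e ^ s := by positivity
    nlinarith
  have hd1 := hα _ h10 h11
  have hd2 := hα _ h20 h21
  obtain ⟨α, hαd⟩ : ∃ α, α = β ^ r := ⟨_, rfl⟩
  rw [← hαd] at hd1 hd2
  obtain ⟨M, hM⟩ : ∃ M, M = muRS N r s ρ := ⟨_, rfl⟩
  rw [← hM]
  set E1 := e1 N ρ with hE1
  set E2 := e2 N ρ with hE2
  have hE1c : 1 / (N : ℝ) * (1 - e1c ρ) = 1 - E1 := by rw [hE1, e1]; ring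
  have hE2c : 1 / (N : ℝ) * (1 - e2c ρ) = 1 - E2 := by rw [hE2, e2]; ring
  let W1 := (1 - E1 ^ s) / (1 - e1c ρ) / (1 - α * E1 ^ s)
  let W2 := (1 - E2 ^ s) / (1 - e2c ρ) / (1 - α * E2 ^ s)
  have hW1 : W1 * (1 - α * E1 ^ s) = (1 - E1 ^ s) / (1 - e1c ρ) := div_mul_cancel₀ _ hd1.ne'
  have hW2 : W2 * (1 - α * E2 ^ s) = (1 - E2 ^ s) / (1 - e2c ρ) := div_mul_cancel₀ _ hd2.ne'
  have hMW : ((r : ℝ) + s) * M / N = (1 - α) * (W1 * m1 + W2 * m2) := by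
    have hrs : (0 : ℝ) < (r : ℝ) + s := by positivity
    have ha : aR N r = (1 - α) / 3 := by rw [aR, hαd, hβ]
    have g1 : (1 - e1c ρ) ≠ 0 := by linarith
    have g2 : (1 - e2c ρ) ≠ 0 := by linarith
    have hQ : (1 + ρ + ρ ^ 2) ≠ 0 := by positivity
    have f1 : W1 * m1 = (1 - E1 ^ s) / (1 - α * E1 ^ s) * (((1 - ρ) * (1 + ρ) * Sq ρ
        + (5 * (1 + ρ) ^ 2 * (1 + ρ ^ 2) - 4 * ρ ^ 2) / 3) * (1 - ρ) ^ 2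
        / (4 * (1 + ρ + ρ ^ 2) ^ 2 * Sq ρ)) := by
      rw [hm1]; simp only [W1]; field_simp
    have f2 : W2 * m2 = (1 - E2 ^ s) / (1 - α * E2 ^ s) * (((1 - ρ) * (1 + ρ) * Sq ρ
        - (5 * (1 + ρ) ^ 2 * (1 + ρ ^ 2) - 4 * ρ ^ 2) / 3) * (1 - ρ) ^ 2
        / (4 * (1 + ρ + ρ ^ 2) ^ 2 * Sq ρ)) := by
      rw [hm2]; simp only [W2]; field_simp
    rw [f1, f2, hM, muRS, Ers, Drs, ha, ← hE1, ← hE2]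
    have k1 : 1 + (3 * ((1 - α) / 3) - 1) * E1 ^ s = 1 - α * E1 ^ s := by ring
    have k2 : 1 + (3 * ((1 - α) / 3) - 1) * E2 ^ s = 1 - α * E2 ^ s := by ring
    rw [k1, k2]
    generalize E1 ^ s = x1 at *
    generalize E2 ^ s = x2 at *
    have d1 := hd1.ne'
    have d2 := hd2.ne'
    have hS0 := hS.ne'
    generalize hy1 : 1 - α * x1 = y1 at *
    generalize hy2 : 1 - α * x2 = y2 at *
    field_simp
    rw [← hy1, ← hy2]
    ring
  -- coefficients
  let X1 : ℕ → ℝ := fun j => E1 ^ j * (α * W1) + (1 - E1 ^ j) / (1 - e1c ρ)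
  let X2 : ℕ → ℝ := fun j => E2 ^ j * (α * W2) + (1 - E2 ^ j) / (1 - e2c ρ)
  have X1s : X1 s = W1 := by simp only [X1]; linear_combination -hW1
  have X2s : X2 s = W2 := by simp only [X2]; linear_combination -hW2
  let G : ℕ → ZMod 3 → ℝ := fun j z => if j ≤ s then X1 j * u1 z + X2 j * u2 z - j * M / N else
    β ^ (j - s) * (W1 * u1 z + W2 * u2 z) - j * M / N + (1 - β ^ (j - s)) * (W1 * m1 + W2 * m2)
  have hGs : ∀ j z, j ≤ s → G j z = X1 j * u1 z + X2 j * u2 z - j * M / N := by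
    intro j z hj; simp only [G, if_pos hj]
  have hGr : ∀ i z, G (s + i) z =
      β ^ i * (W1 * u1 z + W2 * u2 z) - ((s + i : ℕ) : ℝ) * M / N
        + (1 - β ^ i) * (W1 * m1 + W2 * m2) := by
    intro i z
    rcases Nat.eq_zero_or_pos i with rfl | hi
    · rw [hGs _ _ (by omega)]; simp [X1s, X2s]
    · simp only [G, if_neg (show ¬ s + i ≤ s by omega), Nat.add_sub_cancel_left]
  have hclose : ∀ z, G (s + r) z = G 0 z := by
    intro z
    rw [hGr, hGs _ _ (Nat.zero_le _), ← hαd]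
    simp only [X1, X2]
    push_cast
    linear_combination -hMW
  have hstepB : ∀ j z, j < s → G (j + 1) z = G j z
        + (1 / N) * ((2 * p z - 1) + p z * G j (z + 1) + (1 - p z) * G j (z - 1)
          - G j z) - M / N := by
    intro j z hj
    rw [hGs _ _ hj, hGs _ _ hj.le, hGs _ _ hj.le, hGs _ _ hj.le]
    have r1 : X1 (j + 1) = E1 * X1 j + 1 / N := by
      have : (1 / (N : ℝ)) = (1 - E1) / (1 - e1c ρ) := by
        rw [← hE1c]; field_simp [show (1 - e1c ρ) ≠ 0 by linarith]
      simp only [X1]; rw [this]; ring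
    have r2 : X2 (j + 1) = E2 * X2 j + 1 / N := by
      have : (1 / (N : ℝ)) = (1 - E2) / (1 - e2c ρ) := by
        rw [← hE2c]; field_simp [show (1 - e2c ρ) ≠ 0 by linarith]
      simp only [X2]; rw [this]; ring
    rw [r1, r2]
    push_cast
    linear_combination (1 / (N : ℝ)) * hu z - (1 / (N : ℝ)) * X1 j * hB1 z
      - (1 / (N : ℝ)) * X2 j * hB2 z + X1 j * u1 z * hE1c + X2 j * u2 z * hE2c
  have hsum : ∀ (u : ZMod 3 → ℝ) z, u (z + 1) + u (z - 1) + u z = ∑ z, u z := by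
    intro u z
    rw [show ∑ z, u z = u 0 + u 1 + u 2 from Fin.sum_univ_three u]
    fin_cases z
    · change u 1 + u 2 + u 0 = _; ring
    · change u 2 + u 0 + u 1 = _; ring
    · change u 0 + u 1 + u 2 = _; ring
  have hstepA : ∀ i z, G (s + (i + 1)) z = G (s + i) z
        + (1 / N) * (G (s + i) (z + 1) + G (s + i) (z - 1) - 2 * G (s + i) z) - M / N := by
    intro i z
    rw [hGr, hGr, hGr, hGr]
    have q1 := hsum u1 z
    have q2 := hsum u2 z
    have q1' : ∑ z, u1 z = 3 * m1 := by rw [hm1']; ring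
    have q2' : ∑ z, u2 z = 3 * m2 := by rw [hm2']; ring
    rw [q1'] at q1
    rw [q2'] at q2
    push_cast
    rw [pow_succ]
    have hβ' : (1 / (N : ℝ)) * 3 = 1 - β := by rw [hβ]; ring
    linear_combination -β ^ i * W1 / N * q1 - β ^ i * W2 / N * q2
      + β ^ i * (W1 * u1 z + W2 * u2 z - W1 * m1 - W2 * m2) * hβ'
  -- the periodic function
  have hd : 0 < r + s := by omega
  have hnext : ∀ n z, G (s + r - (n + 1) % (r + s)) z = G (s + r - n % (r + s) - 1) z := by
    intro n z
    have hlt := Nat.mod_lt n hd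
    rcases Nat.lt_or_ge (n % (r + s) + 1) (r + s) with h | h
    · have : (n + 1) % (r + s) = n % (r + s) + 1 := by
        rw [Nat.add_mod, Nat.mod_eq_of_lt (show 1 < r + s by omega), Nat.mod_eq_of_lt h]
      rw [this]; rfl
    · have h' : n % (r + s) + 1 = r + s := by omega
      have : (n + 1) % (r + s) = 0 := by
        rw [Nat.add_mod, Nat.mod_eq_of_lt (show 1 < r + s by omega), h', Nat.mod_self]
      rw [this, Nat.sub_zero, hclose, show s + r - n % (r + s) - 1 = 0 by omega]
  refine ⟨fun n z => G (s + r - n % (r + s)) z, ?_, ?_, ?_⟩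
  · refine ⟨∑ j ∈ Finset.range (s + r + 1), ∑ z, |G j z|, fun n z => ?_⟩
    refine le_trans (Finset.single_le_sum (f := fun z => |G (s + r - n % (r + s)) z|)
      (fun _ _ => abs_nonneg _) (Finset.mem_univ z)) ?_
    exact Finset.single_le_sum (f := fun j => ∑ z, |G j z|)
      (fun _ _ => Finset.sum_nonneg fun _ _ => abs_nonneg _) (Finset.mem_range.2 (by omega))
  · intro n z hn
    simp only [hnext]
    have := hstepA (r - n % (r + s) - 1) z
    rw [show s + (r - n % (r + s) - 1 + 1) = s + r - n % (r + s) by omega,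
      show s + (r - n % (r + s) - 1) = s + r - n % (r + s) - 1 by omega] at this
    exact this
  · intro n z hn
    have hlt := Nat.mod_lt n hd
    simp only [hnext]
    have := hstepB (s + r - n % (r + s) - 1) z (by omega)
    rw [show s + r - n % (r + s) - 1 + 1 = s + r - n % (r + s) by omega] at this
    exact this

lemma aux_sumB {N : ℕ} (q : Fin N → ℝ) (q' : Fin N → ℝ) (x : Fin N → ZMod 3)
    (Q : (Fin N → ZMod 3) → ℝ)
    (h1 : ∀ i y, y i = x i + 1 → (∀ j, j ≠ i → y j = x j) → Q y = q i)
    (h2 : ∀ i y, y i = x i - 1 → (∀ j, j ≠ i → y j = x j) → Q y = q' i)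
    (h3 : ∀ y, (¬ ∃ i, (y i = x i + 1 ∨ y i = x i - 1) ∧ ∀ j, j ≠ i → y j = x j) → Q y = 0)
    (f : (Fin N → ZMod 3) → ℝ) :
    ∑ y, Q y * f y = ∑ i, (q i * f (Function.update x i (x i + 1))
      + q' i * f (Function.update x i (x i - 1))) := by
  have ha : ∀ z : ZMod 3, z + 1 ≠ z := by decide
  have hb : ∀ z : ZMod 3, z - 1 ≠ z := by decide
  have hc : ∀ z : ZMod 3, z + 1 ≠ z - 1 := by decide
  let u : Fin N × Bool → (Fin N → ZMod 3) := fun k =>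
    Function.update x k.1 (if k.2 then x k.1 + 1 else x k.1 - 1)
  have hu1 : ∀ i, u (i, true) = Function.update x i (x i + 1) := fun i => rfl
  have hu2 : ∀ i, u (i, false) = Function.update x i (x i - 1) := fun i => rfl
  have hne : ∀ (z : ZMod 3) (b : Bool), (if b then z + 1 else z - 1) ≠ z := by decide
  have hinj : Function.Injective u := by
    rintro ⟨i, b⟩ ⟨j, b'⟩ h
    have hij : i = j := by
      by_contra hij
      have := congrFun h i
      simp only [u, Function.update_self, Function.update_of_ne hij] at this
      exact hne _ _ this
    subst hij
    have := congrFun h i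
    simp only [u, Function.update_self] at this
    have hbb : b = b' := by
      cases b <;> cases b' <;> simp at this ⊢
      · exact hc _ this.symm
      · exact hc _ this
    rw [hbb]
  have := Fintype.sum_of_injective u hinj
    (fun k => (if k.2 then q k.1 else q' k.1) * f (u k)) (fun y => Q y * f y) ?_ ?_
  · rw [← this, Fintype.sum_prod_type]
    refine Finset.sum_congr rfl fun i _ => ?_
    rw [Fintype.sum_bool]
    simp [hu1, hu2]
  · intro y hy
    rw [h3 y, zero_mul]
    rintro ⟨i, h, hj⟩
    apply hy
    rcases h with h | h
    · exact ⟨(i, true), by rw [hu1]; ext j; by_cases hji : j = i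
                           · subst hji; simp [h]
                           · simp [hji, hj j hji]⟩
    · exact ⟨(i, false), by rw [hu2]; ext j; by_cases hji : j = i
                            · subst hji; simp [h]
                            · simp [hji, hj j hji]⟩
  · rintro ⟨i, b⟩
    cases b
    · rw [h2 i (u (i, false)) (by simp [u]) (fun j hj => by simp [u, hj])]; rfl
    · rw [h1 i (u (i, true)) (by simp [u]) (fun j hj => by simp [u, hj])]; rfl

lemma aux_sumA {N : ℕ} (q : ℝ) (x : Fin N → ZMod 3) (Q : (Fin N → ZMod 3) → ℝ)
    (h1 : ∀ i j y, i ≠ j → y i = x i - 1 → y j = x j + 1 → (∀ k, k ≠ i → k ≠ j → y k = x k) →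
      Q y = q)
    (h3 : ∀ y, (¬ ∃ i j, i ≠ j ∧ y i = x i - 1 ∧ y j = x j + 1 ∧ ∀ k, k ≠ i → k ≠ j → y k = x k) →
      Q y = 0)
    (f : (Fin N → ZMod 3) → ℝ) :
    ∑ y, Q y * f y = ∑ k ∈ (Finset.univ : Finset (Fin N)).offDiag,
      q * f (Function.update (Function.update x k.1 (x k.1 - 1)) k.2 (x k.2 + 1)) := by
  have ha : ∀ z : ZMod 3, z + 1 ≠ z := by decide
  have hb : ∀ z : ZMod 3, z - 1 ≠ z := by decide
  have hc : ∀ z : ZMod 3, z + 1 ≠ z - 1 := by decide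
  let u : Fin N × Fin N → (Fin N → ZMod 3) := fun k =>
    Function.update (Function.update x k.1 (x k.1 - 1)) k.2 (x k.2 + 1)
  have hu1 : ∀ i j, i ≠ j → u (i, j) i = x i - 1 := by
    intro i j h; simp [u, Function.update_of_ne h]
  have hu2 : ∀ i j, u (i, j) j = x j + 1 := by intro i j; simp [u]
  have hu3 : ∀ i j k, k ≠ i → k ≠ j → u (i, j) k = x k := by
    intro i j k h h'; simp [u, h, h']
  symm
  refine Finset.sum_of_injOn u ?_ ?_ ?_ ?_
  · rintro ⟨i, j⟩ hij ⟨i', j'⟩ hij' h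
    simp only [Finset.mem_coe, Finset.mem_offDiag, Finset.mem_univ, true_and] at hij hij'
    have hi : i = i' := by
      by_contra hne
      have h1 := congrFun h i
      rw [hu1 i j hij] at h1
      by_cases hj : i = j'
      · rw [← hj, hu2] at h1; exact hc _ h1.symm
      · rw [hu3 _ _ _ hne hj] at h1; exact hb _ h1
    have hj : j = j' := by
      by_contra hne
      have h1 := congrFun h j
      rw [hu2] at h1
      by_cases hj : j = i'
      · rw [← hj, hu1 j j' hne] at h1; exact hc _ h1
      · rw [hu3 _ _ _ hj hne] at h1; exact ha _ h1
    rw [hi, hj]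
  · intro _ _; simp
  · intro y _ hy
    rw [h3 y, zero_mul]
    rintro ⟨i, j, hij, hi, hj, hk⟩
    apply hy
    refine ⟨(i, j), by simpa using hij, ?_⟩
    ext k
    by_cases h : k = i
    · rw [h, hu1 i j hij, hi]
    · by_cases h' : k = j
      · rw [h', hu2, hj]
      · rw [hu3 _ _ _ h h', hk k h h']
  · rintro ⟨i, j⟩ hij
    simp only [Finset.mem_offDiag, Finset.mem_univ, true_and] at hij
    rw [h1 i j (u (i, j)) hij (hu1 i j hij) (hu2 i j) (hu3 i j)]

lemma aux_upd {N : ℕ} (g : ZMod 3 → ℝ) (x : Fin N → ZMod 3) (i : Fin N) (a : ZMod 3) :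
    ∑ k, g (Function.update x i a k) = (∑ k, g (x k)) + (g a - g (x i)) := by
  have : ∀ k, g (Function.update x i a k) = g (x k) + (if k = i then g a - g (x i) else 0) := by
    intro k
    by_cases h : k = i
    · subst h; simp
    · simp [h]
  simp_rw [this, Finset.sum_add_distrib]
  simp

/-- strong law of large numbers for the profit of the ensemble of `N`
players playing the periodic pattern `(A')^r B^s` of Toral's games: almost surely
`Sₙ/n → μ_{[r,s]}^{(N)} = N·E_{r,s}/D_{r,s}`. -/
theorem slln_pattern (ρ : ℝ) (hρ : 0 < ρ) (N : ℕ) (hN : 2 ≤ N)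
    (r s : ℕ) (hr : 1 ≤ r) (hs : 1 ≤ s)
    -- game B transition matrix on Σ_N = (ℤ/3ℤ)^N
    (PB : Matrix (Fin N → ZMod 3) (Fin N → ZMod 3) ℝ)
    (hPBwin : ∀ (x y : Fin N → ZMod 3) (i : Fin N), y i = x i + 1 →
      (∀ j, j ≠ i → y j = x j) →
      PB x y = (if x i = 0 then ρ ^ 2 / (1 + ρ ^ 2) else 1 / (1 + ρ)) / N)
    (hPBlose : ∀ (x y : Fin N → ZMod 3) (i : Fin N), y i = x i - 1 →
      (∀ j, j ≠ i → y j = x j) →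
      PB x y = (1 - (if x i = 0 then ρ ^ 2 / (1 + ρ ^ 2) else 1 / (1 + ρ))) / N)
    (hPBzero : ∀ x y : Fin N → ZMod 3,
      (¬ ∃ i, (y i = x i + 1 ∨ y i = x i - 1) ∧ ∀ j, j ≠ i → y j = x j) → PB x y = 0)
    -- game A' (redistribution) transition matrix on Σ_N
    (PA : Matrix (Fin N → ZMod 3) (Fin N → ZMod 3) ℝ)
    (hPAone : ∀ (x y : Fin N → ZMod 3) (i j : Fin N), i ≠ j →
      y i = x i - 1 → y j = x j + 1 → (∀ k, k ≠ i → k ≠ j → y k = x k) →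
      PA x y = 1 / ((N : ℝ) * ((N : ℝ) - 1)))
    (hPAzero : ∀ x y : Fin N → ZMod 3,
      (¬ ∃ i j, i ≠ j ∧ y i = x i - 1 ∧ y j = x j + 1 ∧ ∀ k, k ≠ i → k ≠ j → y k = x k) →
      PA x y = 0)
    -- the payoff function
    (w : (Fin N → ZMod 3) → (Fin N → ZMod 3) → ℝ)
    (hwwin : ∀ (x y : Fin N → ZMod 3) (i : Fin N), y i = x i + 1 →
      (∀ j, j ≠ i → y j = x j) → w x y = 1)
    (hwlose : ∀ (x y : Fin N → ZMod 3) (i : Fin N), y i = x i - 1 →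
      (∀ j, j ≠ i → y j = x j) → w x y = -1)
    (hwzero : ∀ x y : Fin N → ZMod 3,
      (¬ ∃ i, (y i = x i + 1 ∨ y i = x i - 1) ∧ ∀ j, j ≠ i → y j = x j) → w x y = 0)
    -- the time-inhomogeneous Markov chain: canonical coordinate process under `μ`,
    -- with arbitrary initial distribution, where the transition from time `n` to
    -- time `n+1` is governed by `PA` if `n % (r+s) < r` and by `PB` otherwise
    (μ : Measure (ℕ → (Fin N → ZMod 3))) [IsProbabilityMeasure μ]
    (hMarkov : ∀ (n : ℕ) (f : ℕ → (Fin N → ZMod 3)) (y : Fin N → ZMod 3),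
      μ {ω | (∀ i ≤ n, ω i = f i) ∧ ω (n + 1) = y}
        = μ {ω | ∀ i ≤ n, ω i = f i}
          * ENNReal.ofReal ((if n % (r + s) < r then PA else PB) (f n) y)) :
    ∀ᵐ ω ∂μ, Tendsto
      (fun n : ℕ => (∑ m ∈ Finset.range n, w (ω m) (ω (m + 1))) / (n : ℝ)) atTop
      (nhds (muRS N r s ρ)) := by
  have hN' : (2 : ℝ) ≤ N := by exact_mod_cast hN
  have hN0 : (N : ℝ) ≠ 0 := by linarith
  have hN1 : (N : ℝ) - 1 ≠ 0 := by linarith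
  let p : ZMod 3 → ℝ := fun z => if z = 0 then ρ ^ 2 / (1 + ρ ^ 2) else 1 / (1 + ρ)
  have hp0 : ∀ z, 0 ≤ p z := by
    intro z; simp only [p]; split_ifs <;> positivity
  have hp1 : ∀ z, p z ≤ 1 := by
    intro z; simp only [p]; split_ifs
    · rw [div_le_one (by positivity)]; linarith
    · rw [div_le_one (by positivity)]; linarith
  obtain ⟨h, ⟨C, hC⟩, hA, hB⟩ := aux_poisson ρ hρ N hN r s hr hs p (fun z => rfl)
  obtain ⟨M, hM⟩ : ∃ M, M = muRS N r s ρ := ⟨_, rfl⟩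
  rw [← hM] at hA hB ⊢
  have hPA0 : ∀ x y, 0 ≤ PA x y := by
    intro x y
    by_cases hx : ∃ i j, i ≠ j ∧ y i = x i - 1 ∧ y j = x j + 1 ∧ ∀ k, k ≠ i → k ≠ j → y k = x k
    · obtain ⟨i, j, h1, h2, h3, h4⟩ := hx
      rw [hPAone x y i j h1 h2 h3 h4]
      have : (0 : ℝ) ≤ (N : ℝ) - 1 := by linarith
      positivity
    · rw [hPAzero x y hx]
  have hPB0 : ∀ x y, 0 ≤ PB x y := by
    intro x y
    by_cases hx : ∃ i, (y i = x i + 1 ∨ y i = x i - 1) ∧ ∀ j, j ≠ i → y j = x j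
    · obtain ⟨i, h1 | h1, h2⟩ := hx
      · rw [hPBwin x y i h1 h2]
        exact div_nonneg (hp0 _) (by linarith)
      · rw [hPBlose x y i h1 h2]
        exact div_nonneg (sub_nonneg.2 (hp1 _)) (by linarith)
    · rw [hPBzero x y hx]
  have hw1 : ∀ x y, |w x y| ≤ 1 := by
    intro x y
    by_cases hx : ∃ i, (y i = x i + 1 ∨ y i = x i - 1) ∧ ∀ j, j ≠ i → y j = x j
    · obtain ⟨i, h1 | h1, h2⟩ := hx
      · rw [hwwin x y i h1 h2]; simp
      · rw [hwlose x y i h1 h2]; simp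
    · rw [hwzero x y hx]; simp
  let H : ℕ → (Fin N → ZMod 3) → ℝ := fun n x => ∑ i, h n (x i)
  have hHb : ∀ n x, |H n x| ≤ N * C := by
    intro n x
    refine (Finset.abs_sum_le_sum_abs _ _).trans ?_
    refine (Finset.sum_le_sum fun m _ => hC n _).trans ?_
    simp
  let d : ℕ → (Fin N → ZMod 3) → (Fin N → ZMod 3) → ℝ := fun n x y =>
    w x y + H (n + 1) y - H n x - M
  have hdb : ∀ n x y, |d n x y| ≤ 1 + N * C + N * C + |M| := by
    intro n x y
    refine (abs_sub _ _).trans ?_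
    gcongr
    refine (abs_sub _ _).trans ?_
    gcongr
    · refine (abs_add_le _ _).trans ?_
      gcongr
      · exact hw1 x y
      · exact hHb _ _
    · exact hHb _ _
  have hd0 : ∀ n x, ∑ y, (if n % (r + s) < r then PA else PB) x y * d n x y = 0 := by
    intro n x
    by_cases hn : n % (r + s) < r
    · simp only [if_pos hn]
      rw [aux_sumA (1 / ((N : ℝ) * ((N : ℝ) - 1))) x (PA x)
        (fun i j y => hPAone x y i j) (fun y => hPAzero x y)]
      have hw : ∀ k ∈ (Finset.univ : Finset (Fin N)).offDiag,
          1 / ((N : ℝ) * ((N : ℝ) - 1)) *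
          d n x (Function.update (Function.update x k.1 (x k.1 - 1)) k.2 (x k.2 + 1)) =
          1 / ((N : ℝ) * ((N : ℝ) - 1)) * ((H (n + 1) x - H n x - M)
            + ((h (n + 1) (x k.1 - 1) - h (n + 1) (x k.1))
            + (h (n + 1) (x k.2 + 1) - h (n + 1) (x k.2)))) := by
        rintro ⟨i, j⟩ hij
        simp only [Finset.mem_offDiag, Finset.mem_univ, true_and] at hij
        have ha : ∀ z : ZMod 3, z + 1 ≠ z := by decide
        have hb : ∀ z : ZMod 3, z - 1 ≠ z := by decide
        have hz : w x (Function.update (Function.update x i (x i - 1)) j (x j + 1)) = 0 := by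
          apply hwzero
          rintro ⟨l, -, hl⟩
          by_cases hli : i = l
          · have := hl j (by rw [← hli]; exact hij.symm)
            rw [Function.update_self] at this
            exact ha _ this
          · have := hl i hli
            rw [Function.update_of_ne hij, Function.update_self] at this
            exact hb _ this
        simp only [d, H]
        rw [hz, aux_upd, aux_upd, Function.update_of_ne hij.symm]
        ring
      rw [Finset.sum_congr rfl hw, ← Finset.mul_sum,
        show (Finset.univ : Finset (Fin N)).offDiag =
          (Finset.univ ×ˢ Finset.univ).filter (fun a => a.1 ≠ a.2) by ext; simp,
        Finset.sum_filter]
      have hoff : ∀ F : Fin N × Fin N → ℝ,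
          ∑ a ∈ Finset.univ ×ˢ Finset.univ, (if a.1 ≠ a.2 then F a else 0)
            = ∑ i, ∑ j, F (i, j) - ∑ i, F (i, i) := by
        intro F
        rw [Finset.sum_product, ← Finset.sum_sub_distrib]
        refine Finset.sum_congr rfl fun i _ => ?_
        have : ∀ j, (if i ≠ j then F (i, j) else 0) = F (i, j) - if i = j then F (i, j) else 0 := by
          intro j; by_cases hh : i = j <;> simp [hh]
        simp only [this, Finset.sum_sub_distrib]
        simp
      rw [hoff]
      simp only [Finset.sum_add_distrib, Finset.sum_sub_distrib, Finset.sum_const,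
        Finset.card_univ, Fintype.card_fin, nsmul_eq_mul, ← Finset.mul_sum]
      have hsum : H n x = H (n + 1) x + (1 / N) * ((∑ i, h (n + 1) (x i + 1))
          + (∑ i, h (n + 1) (x i - 1)) - 2 * H (n + 1) x) - M := by
        simp only [H]
        rw [Finset.sum_congr rfl fun i _ => hA n (x i) hn]
        simp only [Finset.sum_add_distrib, Finset.sum_sub_distrib, Finset.sum_const,
          Finset.card_univ, Fintype.card_fin, nsmul_eq_mul, ← Finset.mul_sum]
        field_simp
      rw [hsum]
      simp only [H]
      field_simp
      ring
    · simp only [if_neg hn]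
      rw [aux_sumB (fun i => p (x i) / N) (fun i => (1 - p (x i)) / N) x (PB x)
        (fun i y => hPBwin x y i) (fun i y => hPBlose x y i) (fun y => hPBzero x y)]
      have hw : ∀ i, p (x i) / N * d n x (Function.update x i (x i + 1))
          + (1 - p (x i)) / N * d n x (Function.update x i (x i - 1)) =
          (1 / (N : ℝ)) * (H (n + 1) x - H n x - M) +
          (h n (x i) - h (n + 1) (x i) + M / N) := by
        intro i
        rw [hB n (x i) hn]
        simp only [d]
        rw [hwwin x _ i (by simp) (fun j hj => by simp [hj]),
          hwlose x _ i (by simp) (fun j hj => by simp [hj])]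
        simp only [H]
        rw [aux_upd, aux_upd]
        field_simp
        ring
      rw [Finset.sum_congr rfl fun i _ => hw i]
      simp only [Finset.sum_add_distrib, Finset.sum_sub_distrib, Finset.sum_const,
        Finset.card_univ, Fintype.card_fin, nsmul_eq_mul]
      simp only [H]
      field_simp
      ring
  have main := aux_slln μ (fun n => if n % (r + s) < r then PA else PB)
    (fun n x y => by
      change 0 ≤ (if n % (r + s) < r then PA else PB) x y
      split_ifs
      · exact hPA0 x y
      · exact hPB0 x y) hMarkov d hd0 _ hdb
  filter_upwards [main] with ω hω
  have htel : ∀ n : ℕ, ∑ m ∈ Finset.range n, d m (ω m) (ω (m + 1)) =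
      (∑ m ∈ Finset.range n, w (ω m) (ω (m + 1))) + (H n (ω n) - H 0 (ω 0)) - n * M := by
    intro n
    induction n with
    | zero => simp
    | succ n ih =>
      rw [Finset.sum_range_succ, Finset.sum_range_succ, ih]
      simp only [d]
      push_cast
      ring
  have hHt : Tendsto (fun n : ℕ => (H n (ω n) - H 0 (ω 0)) / (n : ℝ)) atTop (nhds 0) := by
    refine squeeze_zero_norm (a := fun n : ℕ => (N * C + N * C) / (n : ℝ)) (fun n => ?_)
      (tendsto_const_div_atTop_nhds_zero_nat _)
    rw [norm_div, Real.norm_natCast, Real.norm_eq_abs]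
    gcongr
    refine (abs_sub _ _).trans ?_
    exact add_le_add (hHb _ _) (hHb _ _)
  have hfin := (hω.sub hHt).add_const M
  rw [sub_zero, zero_add] at hfin
  refine hfin.congr' ?_
  filter_upwards [eventually_gt_atTop 0] with n hn0
  have hn0' : (n : ℝ) ≠ 0 := by exact_mod_cast hn0.ne'
  rw [htel]
  field_simp
  ring
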